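/- For N = 1 (p₀ = −1): the function Φ(z) = d₀ H_{β}(ξ) + d₁ H_{β+1}(ξ), with β = −1 + q₁/2, ξ = sz − p₁/2, d₀ = 1 and d₁ = (p₁+q₀)/(2(1+β)) (assuming β ≠ −1), solves the biconfluent Heun equation z Φ'' + (−1 + p₁ s z − 2 s² z²) Φ' + (q₀ s + q₁ s² z) Φ = 0 if and only if q₀² + p₁ q₀ + q₁ = 0. -/

import Mathlib

/-- Pochhammer symbol `(x)_k` (rising factorial). -/
noncomputable def ascp (x : ℂ) (k : ℕ) : ℂ := (ascPochhammer ℂ k).eval x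

/-- Kummer confluent hypergeometric function `₁F₁(a; b; x)`. -/
noncomputable def F11 (a b x : ℂ) : ℂ :=
  ∑' k : ℕ, ascp a k / ascp b k * x ^ k / (Nat.factorial k : ℂ)

/-- Hermite function of complex degree `ν`. -/
noncomputable def HermiteF (ν x : ℂ) : ℂ :=
  (2 : ℂ) ^ ν * (Real.sqrt Real.pi : ℂ) *
    (F11 (-ν / 2) (1 / 2) (x ^ 2) / Complex.Gamma ((1 - ν) / 2)
      - 2 * x * F11 ((1 - ν) / 2) (3 / 2) (x ^ 2) / Complex.Gamma (-ν / 2))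

theorem ascp_zero (a : ℂ) : ascp a 0 = 1 := by simp [ascp]

theorem ascp_succ (a : ℂ) (k : ℕ) : ascp a (k + 1) = ascp a k * (a + k) := by
  simp [ascp, ascPochhammer_succ_eval]

theorem ascp_succ_left (a : ℂ) (k : ℕ) : ascp a (k + 1) = a * ascp (a + 1) k := by
  induction k with
  | zero => simp [ascp_succ, ascp_zero]
  | succ k ih => rw [ascp_succ, ih, ascp_succ]; push_cast; ring

theorem half_add_natCast_ne_zero (k : ℕ) : (1 / 2 : ℂ) + k ≠ 0 := by
  intro h
  have h' : ((1 + 2 * k : ℕ) : ℂ) = 0 := by push_cast; linear_combination 2 * h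
  have := Nat.cast_eq_zero.mp h'
  omega

theorem three_halves_add_natCast_ne_zero (k : ℕ) : (3 / 2 : ℂ) + k ≠ 0 := by
  have := half_add_natCast_ne_zero (k + 1)
  push_cast at this
  convert this using 1
  ring

theorem ascp_ne_zero {b : ℂ} (hb : ∀ k : ℕ, b + k ≠ 0) (k : ℕ) : ascp b k ≠ 0 := by
  induction k with
  | zero => simp [ascp_zero]
  | succ k ih => rw [ascp_succ]; exact mul_ne_zero ih (hb k)

theorem ascp_three_halves (k : ℕ) : ascp (3 / 2) k = ascp (1 / 2) k * (2 * k + 1) := by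
  have h := ascp_succ_left (1 / 2) k
  rw [ascp_succ, show (1 / 2 + 1 : ℂ) = 3 / 2 by norm_num] at h
  linear_combination -2 * h

theorem ascp_half_succ (k : ℕ) : ascp (1 / 2) (k + 1) = 1 / 2 * ascp (3 / 2) k := by
  rw [ascp_succ_left, show (1 / 2 + 1 : ℂ) = 3 / 2 by norm_num]

/-- The ratio of consecutive coefficients of the Kummer series tends to zero. -/
theorem tendsto_kummer_ratio (a b : ℂ) :
    Filter.Tendsto (fun k : ℕ => (a + k) / ((b + k) * (k + 1))) Filter.atTop (nhds 0) := by
  have h1 : Filter.Tendsto (fun k : ℕ => (a + k) / (b + k)) Filter.atTop (nhds 1) := by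
    simpa using tendsto_add_mul_div_add_mul_atTop_nhds a b 1 (one_ne_zero (α := ℂ))
  have h2 : Filter.Tendsto (fun k : ℕ => 1 / ((k : ℂ) + 1)) Filter.atTop (nhds 0) :=
    tendsto_one_div_add_atTop_nhds_zero_nat
  have h := h1.mul h2
  simp only [mul_zero] at h
  refine h.congr fun k => ?_
  rw [div_mul_div_comm, mul_one]

theorem summable_norm_kummer (a b x : ℂ) (hb : ∀ k : ℕ, b + k ≠ 0) :
    Summable fun k : ℕ => ‖ascp a k / ascp b k * x ^ k / (Nat.factorial k : ℂ)‖ := by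
  have ht := ((tendsto_kummer_ratio a b).mul_const x).norm
  simp only [zero_mul, norm_zero] at ht
  refine summable_of_ratio_norm_eventually_le (r := 1 / 2) (by norm_num) ?_
  filter_upwards [ht.eventually_le_const (show (0 : ℝ) < 1 / 2 by norm_num)] with k hk
  rw [norm_norm, norm_norm]
  have hbk := ascp_ne_zero hb k
  have hbk' := hb k
  have hf : (Nat.factorial k : ℂ) ≠ 0 := by exact_mod_cast k.factorial_ne_zero
  have hk1 : (k : ℂ) + 1 ≠ 0 := by exact_mod_cast k.succ_ne_zero
  have e : ascp a (k + 1) / ascp b (k + 1) * x ^ (k + 1) / (Nat.factorial (k + 1) : ℂ)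
      = (a + k) / ((b + k) * (k + 1)) * x
        * (ascp a k / ascp b k * x ^ k / (Nat.factorial k : ℂ)) := by
    rw [ascp_succ, ascp_succ, Nat.factorial_succ]
    push_cast
    field_simp
    ring
  rw [e, norm_mul]
  exact mul_le_mul_of_nonneg_right hk (norm_nonneg _)

theorem hasSum_F11 (a b x : ℂ) (hb : ∀ k : ℕ, b + k ≠ 0) :
    HasSum (fun k : ℕ => ascp a k / ascp b k * x ^ k / (Nat.factorial k : ℂ)) (F11 a b x) :=
  (summable_norm_kummer a b x hb).of_norm.hasSum

theorem F11_zero (a b : ℂ) : F11 a b 0 = 1 := by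
  unfold F11
  rw [tsum_eq_single 0 fun k hk => by simp [hk]]
  simp [ascp_zero]

/-- Termwise differentiation of `∑ fₖ(x)`, with an entire family dominated on every ball. -/
theorem differentiable_tsum_and_hasSum_deriv {f : ℕ → ℂ → ℂ} (hf : ∀ k, Differentiable ℂ (f k))
    (u : ℝ → ℕ → ℝ) (hu : ∀ r, Summable (u r)) (hle : ∀ r k x, ‖x‖ < r → ‖f k x‖ ≤ u r k) (x : ℂ) :
    DifferentiableAt ℂ (fun y => ∑' k, f k y) x ∧
      HasSum (fun k => deriv (f k) x) (deriv (fun y => ∑' k, f k y) x) := by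
  have hx : x ∈ Metric.ball (0 : ℂ) (‖x‖ + 1) := by simp
  have hb : ∀ k, ∀ w ∈ Metric.ball (0 : ℂ) (‖x‖ + 1), ‖f k w‖ ≤ u (‖x‖ + 1) k :=
    fun k w hw => hle _ k w (by simpa using hw)
  exact ⟨(Complex.differentiableOn_tsum_of_summable_norm (hu _)
      (fun k => (hf k).differentiableOn) Metric.isOpen_ball hb).differentiableAt
      (Metric.isOpen_ball.mem_nhds hx),
    Complex.hasSum_deriv_of_summable_norm (hu _)
      (fun k => (hf k).differentiableOn) Metric.isOpen_ball hb hx⟩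

theorem hasDerivAt_F11_half_sq (a x : ℂ) :
    HasDerivAt (fun y => F11 a (1 / 2) (y ^ 2)) (4 * a * (x * F11 (a + 1) (3 / 2) (x ^ 2))) x := by
  have key := differentiable_tsum_and_hasSum_deriv
    (f := fun k y => ascp a k / ascp (1 / 2) k * (y ^ 2) ^ k / (Nat.factorial k : ℂ))
    (fun k => by fun_prop)
    (fun r k => ‖ascp a k / ascp (1 / 2) k * ((r : ℂ) ^ 2) ^ k / (Nat.factorial k : ℂ)‖)
    (fun r => summable_norm_kummer a (1 / 2) _ half_add_natCast_ne_zero)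
    (fun r k y hy => by
      simp only [norm_div, norm_mul, norm_pow, Complex.norm_real]
      gcongr
      exact hy.le.trans (le_abs_self r)) x
  have hs := (hasSum_nat_add_iff' 1).mpr key.2
  have h2 := (hasSum_F11 (a + 1) (3 / 2) (x ^ 2) three_halves_add_natCast_ne_zero).mul_left
    (4 * a * x)
  have hterm : ∀ k : ℕ,
      deriv (fun y : ℂ => ascp a (k + 1) / ascp (1 / 2) (k + 1) * (y ^ 2) ^ (k + 1) /
        (Nat.factorial (k + 1) : ℂ)) x
      = 4 * a * x * (ascp (a + 1) k / ascp (3 / 2) k * (x ^ 2) ^ k / (Nat.factorial k : ℂ)) := by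
    intro k
    have hd := ((((hasDerivAt_pow 2 x).pow (k + 1)).const_mul
      (ascp a (k + 1) / ascp (1 / 2) (k + 1))).div_const (Nat.factorial (k + 1) : ℂ)).deriv
    refine hd.trans ?_
    have hb := ascp_ne_zero three_halves_add_natCast_ne_zero k
    have hf : (Nat.factorial k : ℂ) ≠ 0 := by exact_mod_cast k.factorial_ne_zero
    have hk1 : (k : ℂ) + 1 ≠ 0 := by exact_mod_cast k.succ_ne_zero
    rw [ascp_half_succ, ascp_succ_left, Nat.factorial_succ]
    push_cast
    field_simp
    ring
  have hz : deriv (fun y : ℂ => ascp a 0 / ascp (1 / 2) 0 * (y ^ 2) ^ 0 /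
      (Nat.factorial 0 : ℂ)) x = 0 := by simp
  rw [Finset.sum_range_one, hz, sub_zero] at hs
  rw [← mul_assoc, h2.unique (hs.congr_fun fun k => (hterm k).symm)]
  exact key.1.hasDerivAt

theorem hasDerivAt_mul_F11_three_halves_sq (a x : ℂ) :
    HasDerivAt (fun y => y * F11 a (3 / 2) (y ^ 2)) (F11 a (1 / 2) (x ^ 2)) x := by
  have key := differentiable_tsum_and_hasSum_deriv
    (f := fun k y => y * (ascp a k / ascp (3 / 2) k * (y ^ 2) ^ k / (Nat.factorial k : ℂ)))
    (fun k => by fun_prop)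
    (fun r k => |r| *
      ‖ascp a k / ascp (3 / 2) k * ((r : ℂ) ^ 2) ^ k / (Nat.factorial k : ℂ)‖)
    (fun r => (summable_norm_kummer a (3 / 2) _ three_halves_add_natCast_ne_zero).mul_left _)
    (fun r k y hy => by
      have hy' := hy.le.trans (le_abs_self r)
      simp only [norm_div, norm_mul, norm_pow, Complex.norm_real, Real.norm_eq_abs]
      gcongr) x
  have hterm : ∀ k : ℕ,
      deriv (fun y : ℂ => y * (ascp a k / ascp (3 / 2) k * (y ^ 2) ^ k /
        (Nat.factorial k : ℂ))) x
      = ascp a k / ascp (1 / 2) k * (x ^ 2) ^ k / (Nat.factorial k : ℂ) := by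
    intro k
    have hb := ascp_ne_zero half_add_natCast_ne_zero k
    have hb' := ascp_ne_zero three_halves_add_natCast_ne_zero k
    have hf : (Nat.factorial k : ℂ) ≠ 0 := by exact_mod_cast k.factorial_ne_zero
    have he : (fun y : ℂ => y * (ascp a k / ascp (3 / 2) k * (y ^ 2) ^ k /
        (Nat.factorial k : ℂ)))
        = fun y => ascp a k / ascp (3 / 2) k / (Nat.factorial k : ℂ) * y ^ (2 * k + 1) := by
      funext y
      ring
    rw [he, ((hasDerivAt_pow (2 * k + 1) x).const_mul _).deriv]
    rw [ascp_three_halves] at hb' ⊢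
    have hk : (2 * k + 1 : ℂ) ≠ 0 := right_ne_zero_of_mul hb'
    push_cast
    field_simp
    ring
  have h0 := (key.2.congr_fun fun k => (hterm k).symm).unique
    (hasSum_F11 a (1 / 2) (x ^ 2) half_add_natCast_ne_zero)
  have hF : (fun y => y * F11 a (3 / 2) (y ^ 2)) = fun y => ∑' k : ℕ,
      y * (ascp a k / ascp (3 / 2) k * (y ^ 2) ^ k / (Nat.factorial k : ℂ)) := by
    funext y
    rw [tsum_mul_left]
    rfl
  rw [← h0, hF]
  exact key.1.hasDerivAt

theorem F11_half_add_one_sub (a y : ℂ) :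
    F11 (a + 1) (1 / 2) y - F11 a (1 / 2) y = 2 * y * F11 (a + 1) (3 / 2) y := by
  have h1 := (hasSum_F11 (a + 1) (1 / 2) y half_add_natCast_ne_zero).sub
    (hasSum_F11 a (1 / 2) y half_add_natCast_ne_zero)
  have h2 := (hasSum_F11 (a + 1) (3 / 2) y three_halves_add_natCast_ne_zero).mul_left (2 * y)
  have h3 := (hasSum_nat_add_iff' 1).mpr h1
  simp only [Finset.sum_range_one, ascp_zero, sub_self, sub_zero] at h3
  refine h3.unique (h2.congr_fun fun k => ?_)
  have hb := ascp_ne_zero three_halves_add_natCast_ne_zero k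
  have hf : (Nat.factorial k : ℂ) ≠ 0 := by exact_mod_cast k.factorial_ne_zero
  have hk1 : (k : ℂ) + 1 ≠ 0 := by exact_mod_cast k.succ_ne_zero
  rw [ascp_half_succ, ascp_succ_left a, ascp_succ, Nat.factorial_succ]
  push_cast
  field_simp
  ring

theorem two_mul_F11_three_halves_add_one (b y : ℂ) :
    2 * b * F11 (b + 1) (3 / 2) y
      = F11 b (1 / 2) y + (2 * b - 1) * F11 b (3 / 2) y := by
  have h1 := (hasSum_F11 (b + 1) (3 / 2) y three_halves_add_natCast_ne_zero).mul_left (2 * b)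
  have h2 := (hasSum_F11 b (1 / 2) y half_add_natCast_ne_zero).add
    ((hasSum_F11 b (3 / 2) y three_halves_add_natCast_ne_zero).mul_left (2 * b - 1))
  refine h1.unique (h2.congr_fun fun k => ?_)
  have hb := ascp_ne_zero half_add_natCast_ne_zero k
  have hb' := ascp_ne_zero three_halves_add_natCast_ne_zero k
  have hf : (Nat.factorial k : ℂ) ≠ 0 := by exact_mod_cast k.factorial_ne_zero
  have h : ascp (b + 1) k * b = ascp b k * (b + k) := by
    rw [← ascp_succ, ascp_succ_left, mul_comm]
  rw [ascp_three_halves] at hb' ⊢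
  have hk : (2 * k + 1 : ℂ) ≠ 0 := right_ne_zero_of_mul hb'
  field_simp
  linear_combination 2 * y ^ k * h

theorem inv_Gamma_eq (z : ℂ) : (Complex.Gamma z)⁻¹ = z * (Complex.Gamma (z + 1))⁻¹ := by
  simpa using Complex.one_div_Gamma_eq_self_mul_one_div_Gamma_add_one z

theorem two_cpow_add_one (ν : ℂ) : (2 : ℂ) ^ (ν + 1) = 2 * 2 ^ ν := by
  rw [Complex.cpow_add _ _ two_ne_zero, Complex.cpow_one, mul_comm]

theorem hasDerivAt_HermiteF (ν x : ℂ) :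
    HasDerivAt (HermiteF ν) (2 * ν * HermiteF (ν - 1) x) x := by
  have h := (((hasDerivAt_F11_half_sq (-ν / 2) x).div_const (Complex.Gamma ((1 - ν) / 2))).sub
    (((hasDerivAt_mul_F11_three_halves_sq ((1 - ν) / 2) x).const_mul 2).div_const
      (Complex.Gamma (-ν / 2)))).const_mul ((2 : ℂ) ^ ν * (Real.sqrt Real.pi : ℂ))
  have hfun : HermiteF ν = fun y => (2 : ℂ) ^ ν * (Real.sqrt Real.pi : ℂ) *
      (F11 (-ν / 2) (1 / 2) (y ^ 2) / Complex.Gamma ((1 - ν) / 2)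
        - 2 * (y * F11 ((1 - ν) / 2) (3 / 2) (y ^ 2)) / Complex.Gamma (-ν / 2)) := by
    funext y
    rw [HermiteF, mul_assoc 2 y]
  rw [hfun]
  refine h.congr_deriv ?_
  have hp := two_cpow_add_one (ν - 1)
  rw [sub_add_cancel] at hp
  have hG := inv_Gamma_eq (-ν / 2)
  rw [HermiteF, hp, show -(ν - 1) / 2 = (1 - ν) / 2 by ring,
    show (1 - (ν - 1)) / 2 = -ν / 2 + 1 by ring]
  simp only [div_eq_mul_inv (_ : ℂ) (Complex.Gamma _)]
  rw [hG]
  ring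

theorem HermiteF_add_one (ν x : ℂ) :
    HermiteF (ν + 1) x = 2 * x * HermiteF ν x - 2 * ν * HermiteF (ν - 1) x := by
  have hp := two_cpow_add_one (ν - 1)
  rw [sub_add_cancel] at hp
  have hG := inv_Gamma_eq (-ν / 2)
  have hG' := inv_Gamma_eq (-(ν + 1) / 2)
  have hE := F11_half_add_one_sub (-(ν + 1) / 2) (x ^ 2)
  have hO := two_mul_F11_three_halves_add_one (-ν / 2) (x ^ 2)
  rw [show -(ν + 1) / 2 + 1 = (1 - ν) / 2 by ring] at hG' hE
  rw [HermiteF, HermiteF, HermiteF, two_cpow_add_one, hp,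
    show -(ν - 1) / 2 = (1 - ν) / 2 by ring,
    show (1 - (ν - 1)) / 2 = -ν / 2 + 1 by ring,
    show (1 - (ν + 1)) / 2 = -ν / 2 by ring]
  simp only [div_eq_mul_inv (_ : ℂ) (Complex.Gamma _)]
  rw [hG, hG']
  generalize (Complex.Gamma (-ν / 2 + 1))⁻¹ = g at *
  generalize (Complex.Gamma ((1 - ν) / 2))⁻¹ = g' at *
  linear_combination (2 * 2 ^ (ν - 1) * (Real.sqrt Real.pi : ℂ) * ν * g) * hE
    + (4 * 2 ^ (ν - 1) * (Real.sqrt Real.pi : ℂ) * x * g') * hO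

theorem exists_HermiteF_ne_zero (ν : ℂ) : ∃ x, HermiteF ν x ≠ 0 := by
  by_contra! h
  have hc : ∀ μ : ℂ, (2 : ℂ) ^ μ * (Real.sqrt Real.pi : ℂ) ≠ 0 := fun μ =>
    mul_ne_zero (by simp [Complex.cpow_eq_zero_iff]) (by simp [Real.sqrt_eq_zero', Real.pi_pos])
  have h0 := h 0
  have hfun : HermiteF ν = fun _ => 0 := funext h
  have h1 := (hasDerivAt_HermiteF ν 0).unique (hfun ▸ hasDerivAt_const 0 0)
  simp only [HermiteF, ne_eq, OfNat.ofNat_ne_zero, not_false_eq_true, zero_pow, F11_zero,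
    mul_zero, zero_mul, zero_div, sub_zero, mul_eq_zero, hc, false_or, one_div, inv_eq_zero] at h0 h1
  rw [Complex.Gamma_eq_zero_iff] at h0
  obtain ⟨m, hm⟩ := h0
  rcases h1 with h1 | h1
  · refine half_add_natCast_ne_zero m ?_
    rw [h1] at hm
    linear_combination hm
  rw [Complex.Gamma_eq_zero_iff] at h1
  obtain ⟨n, hn⟩ := h1
  have hmn : ((2 * m + 1 : ℕ) : ℂ) = ((2 * n + 2 : ℕ) : ℂ) := by
    push_cast
    linear_combination 2 * hm - 2 * hn
  have := Nat.cast_injective hmn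
  omega

theorem bhe_operator_hermite_combination (p₁ q₀ s β d₁ : ℂ) (Φ : ℂ → ℂ)
    (hΦ : Φ = fun z => HermiteF β (s * z - p₁ / 2) + d₁ * HermiteF (β + 1) (s * z - p₁ / 2))
    (hd₁ : d₁ * (2 * (1 + β)) = p₁ + q₀) (z : ℂ) :
    z * deriv (deriv Φ) z + (-1 + p₁ * s * z - 2 * s ^ 2 * z ^ 2) * deriv Φ z
        + (q₀ * s + 2 * (1 + β) * s ^ 2 * z) * Φ z
      = s * (1 + q₀ * d₁) * HermiteF (β + 1) (s * z - p₁ / 2) := by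
  have hH : ∀ ν w : ℂ, HasDerivAt (fun z => HermiteF ν (s * z - p₁ / 2))
      (2 * ν * HermiteF (ν - 1) (s * w - p₁ / 2) * s) w := fun ν w =>
    HasDerivAt.comp (h₂ := HermiteF ν) (h := fun z => s * z - p₁ / 2) w
      (hasDerivAt_HermiteF ν (s * w - p₁ / 2)) ((((hasDerivAt_id w).const_mul s).sub_const (p₁ / 2)).congr_deriv (mul_one s))
  have hΦ' : deriv Φ = fun w => 2 * β * s * HermiteF (β - 1) (s * w - p₁ / 2)
      + d₁ * (2 * (β + 1) * s) * HermiteF β (s * w - p₁ / 2) := by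
    funext w
    rw [hΦ, ((hH β w).fun_add ((hH (β + 1) w).const_mul d₁)).deriv, add_sub_cancel_right]
    ring
  have hΦ'' : deriv (deriv Φ) z = 2 * β * s * (2 * (β - 1) *
        HermiteF (β - 1 - 1) (s * z - p₁ / 2) * s)
      + d₁ * (2 * (β + 1) * s) * (2 * β * HermiteF (β - 1) (s * z - p₁ / 2) * s) := by
    rw [hΦ', (((hH (β - 1) z).const_mul _).fun_add ((hH β z).const_mul _)).deriv]
  have r1 := HermiteF_add_one β (s * z - p₁ / 2)
  have r2 := HermiteF_add_one (β - 1) (s * z - p₁ / 2)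
  rw [sub_add_cancel] at r2
  rw [hΦ'', hΦ', hΦ]
  simp only
  generalize HermiteF (β - 1 - 1) (s * z - p₁ / 2) = A at *
  generalize HermiteF (β - 1) (s * z - p₁ / 2) = B at *
  generalize HermiteF β (s * z - p₁ / 2) = C at *
  generalize HermiteF (β + 1) (s * z - p₁ / 2) = D at *
  linear_combination (2 * β * s ^ 2 * z) * r2 + (2 * (1 + β) * s ^ 2 * z * d₁ - s) * r1
    - s * C * hd₁

/-- for `N = 1` (`p₀ = −1`), the two-term Hermite combination solves the
biconfluent Heun equation iff `q₀² + p₁ q₀ + q₁ = 0`. -/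
theorem bhe_hermite_N1_iff (p₁ q₀ q₁ s : ℂ) (hs : s ≠ 0) (hq₁ : q₁ ≠ 0)
    (β : ℂ) (hβ : β = -1 + q₁ / 2) (d₁ : ℂ) (hd₁ : d₁ = (p₁ + q₀) / (2 * (1 + β)))
    (Φ : ℂ → ℂ)
    (hΦ : Φ = fun z => HermiteF β (s * z - p₁ / 2) + d₁ * HermiteF (β + 1) (s * z - p₁ / 2)) :
    (∀ z : ℂ, z * deriv (deriv Φ) z + (-1 + p₁ * s * z - 2 * s ^ 2 * z ^ 2) * deriv Φ z
        + (q₀ * s + q₁ * s ^ 2 * z) * Φ z = 0)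
    ↔ q₀ ^ 2 + p₁ * q₀ + q₁ = 0 := by
  have hβ1 : 2 * (1 + β) = q₁ := by rw [hβ]; ring
  rw [hβ1] at hd₁
  have hd : d₁ * q₁ = p₁ + q₀ := by rw [hd₁, div_mul_cancel₀ _ hq₁]
  have key := bhe_operator_hermite_combination p₁ q₀ s β d₁ Φ hΦ (by rw [hβ1, hd])
  rw [hβ1] at key
  simp only [key]
  have hiff : 1 + q₀ * d₁ = 0 ↔ q₀ ^ 2 + p₁ * q₀ + q₁ = 0 := by
    rw [← mul_left_inj' hq₁, zero_mul]
    constructor <;> intro h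
    · linear_combination h - q₀ * hd
    · linear_combination h + q₀ * hd
  rw [← hiff]
  constructor
  · intro h
    obtain ⟨x, hx⟩ := exists_HermiteF_ne_zero (β + 1)
    have h' := h ((x + p₁ / 2) / s)
    rw [mul_div_cancel₀ _ hs, add_sub_cancel_right] at h'
    simpa [hs, hx] using h'
  · intro h z
    rw [h]
    ring
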